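/- Say that a real β > 1 is associated to an alternate Lyndon word (d_i)_{i≥1} if the Lyndon system M((d_i)) has topological entropy log β. Let \overline{d_1 d_2 ⋯ d_n} (periodic repetition of d_1⋯d_n, with n minimal) be a weak alternate Lyndon word associated to a real β > 1. Then every alternate Lyndon word (a_i)_{i≥1} satisfying d_1 d_2 ⋯ d_{n−1}(d_n − 1) 0 \overline{d_1 ⋯ d_n} ⪯ (a_i)_{i≥1} ⪯ \overline{d_1 d_2 ⋯ d_n} (if n is even), respectively d_1 d_2 ⋯ d_n \overline{d_1 ⋯ d_{n−1}(d_n − 1) 0} ⪯ (a_i)_{i≥1} ⪯ \overline{d_1 ⋯ d_{n−1}(d_n − 1) 0} (if n is odd), is associated to β. -/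

import Mathlib

open Filter Topology

/-- Alternate (Ito–Sadahiro) strict order on infinite sequences (0-indexed: entry `i`
is the `(i+1)`-th letter `x_{i+1}` of the paper). `altLt x y` iff at the first index
where they differ the comparison alternates with the parity of the index:
`(-1)^k (x_k - y_k) < 0` in 1-based indexing. -/
def altLt (x y : ℕ → ℕ) : Prop :=
  ∃ k : ℕ, (∀ i < k, x i = y i) ∧ (if Even k then y k < x k else x k < y k)

def altLe (x y : ℕ → ℕ) : Prop := x = y ∨ altLt x y

def shiftSeq (x : ℕ → ℕ) (k : ℕ) : ℕ → ℕ := fun i => x (k + i)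

/-- An alternate Lyndon word: smaller (in the alternate order) than all of its shifts. -/
def IsAltLyndon (d : ℕ → ℕ) : Prop := ∀ k : ℕ, altLe d (shiftSeq d k)

/-- The Lyndon system associated to `d`: sequences over the alphabet `{0, …, d_1}`
all of whose shifts dominate `d` in the alternate order. -/
def LyndonSystem (d : ℕ → ℕ) : Set (ℕ → ℕ) :=
  {x | (∀ i, x i ≤ d 0) ∧ ∀ k : ℕ, altLe d (shiftSeq x k)}

def IsFactorOf (w : List ℕ) (x : ℕ → ℕ) : Prop :=
  ∃ k : ℕ, w = (List.range w.length).map (fun i => x (k + i))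

/-- The language of the Lyndon system: finite factors of its elements. -/
def LyndonLang (d : ℕ → ℕ) : Set (List ℕ) :=
  {w | ∃ x ∈ LyndonSystem d, IsFactorOf w x}

/-- `Hword d n` is the number of words of length `n` in the language `L_M`. -/
noncomputable def Hword (d : ℕ → ℕ) (n : ℕ) : ℕ :=
  Set.ncard {w : List ℕ | w ∈ LyndonLang d ∧ w.length = n}

/-- The topological entropy of the Lyndon system of `d` equals `h`,
i.e. `lim_{n→∞} (log H_n)/n = h`. -/
def EntropyIs (d : ℕ → ℕ) (h : ℝ) : Prop :=
  Filter.Tendsto (fun n : ℕ => Real.log (Hword d n) / n) Filter.atTop (nhds h)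

/-- The periodic infinite word `\overline{w}` associated to a finite word `w`. -/
def periodicSeq (w : List ℕ) : ℕ → ℕ := fun i => w.getD (i % w.length) 0
/-- The infinite word `p \overline{w}`: the finite word `p` followed by the
periodic repetition of `w`. -/
def prefixPeriodic (p w : List ℕ) : ℕ → ℕ :=
  fun i => if i < p.length then p.getD i 0 else w.getD ((i - p.length) % w.length) 0

/-- From the word `d_1 ⋯ d_n` produce the word `d_1 ⋯ d_{n−1} (d_n − 1) 0`. -/
def modList (w : List ℕ) : List ℕ :=
  w.take (w.length - 1) ++ [w.getD (w.length - 1) 0 - 1, 0]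


namespace AltL

/-! ### Basic order facts -/

def phi (x : ℕ → ℕ) : Lex (ℕ → ℤ) :=
  toLex (fun i => if Even i then -(x i : ℤ) else (x i : ℤ))

lemma phi_apply (x : ℕ → ℕ) (i : ℕ) :
    (phi x) i = if Even i then -(x i : ℤ) else (x i : ℤ) := rfl

lemma phi_inj {x y : ℕ → ℕ} (h : phi x = phi y) : x = y := by
  funext i
  have h1 := congrFun (toLex.injective h) i
  by_cases hi : Even i <;> simp [hi] at h1 <;> exact h1

lemma altLt_iff (x y : ℕ → ℕ) : altLt x y ↔ phi x < phi y := by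
  have : phi x < phi y ↔ ∃ i, (∀ j < i, (phi x) j = (phi y) j) ∧ (phi x) i < (phi y) i := Iff.rfl
  rw [this]
  unfold altLt
  refine exists_congr fun k => and_congr ?_ ?_
  · refine forall₂_congr fun i _ => ?_
    by_cases hi : Even i <;> simp [phi_apply, hi]
  · by_cases hi : Even k <;> simp [phi_apply, hi]

lemma altLe_iff (x y : ℕ → ℕ) : altLe x y ↔ phi x ≤ phi y := by
  unfold altLe
  rw [le_iff_eq_or_lt, altLt_iff]
  exact or_congr ⟨fun h => h ▸ rfl, phi_inj⟩ Iff.rfl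

lemma le_refl' (x : ℕ → ℕ) : altLe x x := Or.inl rfl
lemma le_trans' {x y z : ℕ → ℕ} (h : altLe x y) (h' : altLe y z) : altLe x z := by
  rw [altLe_iff] at *; exact h.trans h'
lemma le_antisymm' {x y : ℕ → ℕ} (h : altLe x y) (h' : altLe y x) : x = y := by
  rw [altLe_iff] at *; exact phi_inj (le_antisymm h h')
lemma not_le' {x y : ℕ → ℕ} : ¬ altLe x y ↔ altLt y x := by
  rw [altLe_iff, altLt_iff]; exact not_le
lemma not_lt' {x y : ℕ → ℕ} : ¬ altLt x y ↔ altLe y x := by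
  rw [altLe_iff, altLt_iff]; exact not_lt
lemma lt_of_le_of_ne' {x y : ℕ → ℕ} (h : altLe x y) (h' : x ≠ y) : altLt x y := by
  rcases h with h | h
  · exact absurd h h'
  · exact h

/-! ### cons and cat -/

def cons (c : ℕ) (y : ℕ → ℕ) : ℕ → ℕ := fun i => Nat.casesOn i c y

@[simp] lemma cons_zero (c : ℕ) (y : ℕ → ℕ) : cons c y 0 = c := rfl
@[simp] lemma cons_succ (c : ℕ) (y : ℕ → ℕ) (i : ℕ) : cons c y (i + 1) = y i := rfl

lemma lt_cons (c c' : ℕ) (x y : ℕ → ℕ) :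
    altLt (cons c x) (cons c' y) ↔ c' < c ∨ (c = c' ∧ altLt y x) := by
  constructor
  · rintro ⟨k, h1, h2⟩
    rcases k with _ | k
    · left; simpa using h2
    · right
      refine ⟨by simpa using h1 0 (by omega), k, fun i hi => ?_, ?_⟩
      · simpa using (h1 (i + 1) (by omega)).symm
      · by_cases hk : Even k <;> simp [hk, Nat.even_add_one] at h2 ⊢ <;> exact h2
  · rintro (h | ⟨rfl, k, h1, h2⟩)
    · exact ⟨0, by simp, by simpa using h⟩
    · refine ⟨k + 1, fun i hi => ?_, ?_⟩
      · rcases i with _ | i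
        · rfl
        · simpa using (h1 i (by omega)).symm
      · by_cases hk : Even k <;> simp [hk, Nat.even_add_one] at h2 ⊢ <;> exact h2

lemma cons_inj {c c' : ℕ} {x y : ℕ → ℕ} : cons c x = cons c' y ↔ c = c' ∧ x = y := by
  constructor
  · intro h
    refine ⟨by simpa using congrFun h 0, funext fun i => by simpa using congrFun h (i + 1)⟩
  · rintro ⟨rfl, rfl⟩; rfl

lemma le_cons (c c' : ℕ) (x y : ℕ → ℕ) :
    altLe (cons c x) (cons c' y) ↔ c' < c ∨ (c = c' ∧ altLe y x) := by
  rw [altLe, lt_cons, cons_inj, altLe, eq_comm (a := y)]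
  tauto

lemma cons_eta (x : ℕ → ℕ) : cons (x 0) (shiftSeq x 1) = x := by
  funext i
  rcases i with _ | i
  · rfl
  · simp [shiftSeq, add_comm]

lemma le_head {x y : ℕ → ℕ} (h : altLe x y) : y 0 ≤ x 0 := by
  rw [← cons_eta x, ← cons_eta y, le_cons] at h
  omega

def cat (u : List ℕ) (y : ℕ → ℕ) : ℕ → ℕ := u.foldr cons y

@[simp] lemma cat_nil (y : ℕ → ℕ) : cat [] y = y := rfl
@[simp] lemma cat_cons (c : ℕ) (u : List ℕ) (y : ℕ → ℕ) : cat (c :: u) y = cons c (cat u y) := rfl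
lemma cat_append (u v : List ℕ) (y : ℕ → ℕ) : cat (u ++ v) y = cat u (cat v y) := by
  simp [cat]

lemma cat_apply (u : List ℕ) (y : ℕ → ℕ) (i : ℕ) :
    cat u y i = if i < u.length then u.getD i 0 else y (i - u.length) := by
  induction u generalizing i with
  | nil => simp
  | cons c u ih =>
    rcases i with _ | i
    · simp
    · simp [ih]

lemma le_cat (u : List ℕ) (x y : ℕ → ℕ) :
    altLe (cat u x) (cat u y) ↔ if Even u.length then altLe x y else altLe y x := by
  induction u generalizing x y with
  | nil => simp
  | cons c u ih =>
    rw [cat_cons, cat_cons, le_cons]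
    by_cases h : Even u.length <;> simp [ih, h, Nat.even_add_one]

lemma le_cat_even {u : List ℕ} (h : Even u.length) {x y : ℕ → ℕ} :
    altLe (cat u x) (cat u y) ↔ altLe x y := by rw [le_cat, if_pos h]
lemma le_cat_odd {u : List ℕ} (h : ¬ Even u.length) {x y : ℕ → ℕ} :
    altLe (cat u x) (cat u y) ↔ altLe y x := by rw [le_cat, if_neg h]

lemma le_cat_ne (u v : List ℕ) (hl : u.length = v.length) (hne : u ≠ v) (x y x' y' : ℕ → ℕ)
    (h : altLe (cat u x) (cat v y)) : altLe (cat u x') (cat v y') := by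
  suffices H : ∀ (u v : List ℕ) (_ : u.length = v.length) (_ : u ≠ v) (x y x' y' : ℕ → ℕ),
      altLe (cat u x) (cat v y) → altLe (cat u x') (cat v y') from H u v hl hne x y x' y' h
  intro u
  induction h : u.length generalizing u with
  | zero =>
    intro v hv hne
    simp at h; subst h
    exact absurd (List.length_eq_zero_iff.1 hv.symm).symm hne
  | succ n ih =>
    rcases u with _ | ⟨c, u⟩
    · simp at h
    intro v hv hne x y x' y'
    rcases v with _ | ⟨c', v⟩
    · simp at hv
    simp at h hv
    rw [cat_cons, cat_cons, cat_cons, cat_cons, le_cons, le_cons]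
    rintro (h1 | ⟨rfl, h1⟩)
    · exact Or.inl h1
    · exact Or.inr ⟨rfl, ih v hv.symm u h.symm (fun e => hne (by rw [e])) _ _ _ _ h1⟩

def pre (x : ℕ → ℕ) (N : ℕ) : List ℕ := (List.range N).map x

@[simp] lemma pre_length (x : ℕ → ℕ) (N : ℕ) : (pre x N).length = N := by simp [pre]

lemma pre_succ (x : ℕ → ℕ) (N : ℕ) : pre x (N + 1) = x 0 :: pre (shiftSeq x 1) N := by
  simp [pre, List.range_succ_eq_map, shiftSeq, Function.comp_def, add_comm]

@[simp] lemma pre_zero (x : ℕ → ℕ) : pre x 0 = [] := rfl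

lemma shift_shift (x : ℕ → ℕ) (j k : ℕ) : shiftSeq (shiftSeq x j) k = shiftSeq x (j + k) := by
  funext i; simp [shiftSeq, add_assoc]

@[simp] lemma shift_zero (x : ℕ → ℕ) : shiftSeq x 0 = x := by
  funext i; simp [shiftSeq]

@[simp] lemma shift_cons (c : ℕ) (y : ℕ → ℕ) : shiftSeq (cons c y) 1 = y := by
  funext i; simp [shiftSeq, add_comm 1 i]

lemma shift_cons_succ (c : ℕ) (y : ℕ → ℕ) (k : ℕ) :
    shiftSeq (cons c y) (k + 1) = shiftSeq y k := by
  rw [add_comm, ← shift_shift, shift_cons]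

lemma cat_pre (x : ℕ → ℕ) (N : ℕ) : cat (pre x N) (shiftSeq x N) = x := by
  induction N generalizing x with
  | zero => simp
  | succ N ih =>
    rw [pre_succ, cat_cons, add_comm, ← shift_shift, ih, cons_eta]

lemma shift_cat (u : List ℕ) (y : ℕ → ℕ) (k : ℕ) (hk : k ≤ u.length) :
    shiftSeq (cat u y) k = cat (u.drop k) y := by
  induction u generalizing k with
  | nil => simp at hk; simp [hk]
  | cons c u ih =>
    rcases k with _ | k
    · simp
    · rw [cat_cons, shift_cons_succ, ih _ (by simpa using hk)]; simp

lemma shift_cat_len (u : List ℕ) (y : ℕ → ℕ) : shiftSeq (cat u y) u.length = y := by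
  rw [shift_cat _ _ _ le_rfl]; simp

lemma pre_add (x : ℕ → ℕ) (a b : ℕ) : pre x (a + b) = pre x a ++ pre (shiftSeq x a) b := by
  simp [pre, List.range_add, shiftSeq, Function.comp_def]

lemma pre_cat (u : List ℕ) (y : ℕ → ℕ) (m : ℕ) :
    pre (cat u y) m = (u ++ pre y (m - u.length)).take m := by
  induction u generalizing m with
  | nil => simp [List.take_of_length_le]
  | cons c u ih =>
    rcases m with _ | m
    · simp
    · rw [pre_succ, cat_cons, shift_cons, ih]; simp

lemma pre_cat_len (u : List ℕ) (y : ℕ → ℕ) : pre (cat u y) u.length = u := by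
  rw [pre_cat]; simp

lemma pre_take (x : ℕ → ℕ) {a b : ℕ} (h : a ≤ b) : (pre x b).take a = pre x a := by
  obtain ⟨c, rfl⟩ := Nat.exists_eq_add_of_le h
  rw [pre_add]; simp

lemma periodic_cat (w : List ℕ) (hw : 1 ≤ w.length) : periodicSeq w = cat w (periodicSeq w) := by
  funext i
  rw [cat_apply]
  split_ifs with h
  · simp [periodicSeq, Nat.mod_eq_of_lt h]
  · simp only [periodicSeq]
    rw [← Nat.mod_eq_sub_mod (by omega)]

lemma prefixPeriodic_cat (p w : List ℕ) : prefixPeriodic p w = cat p (periodicSeq w) := by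
  funext i
  rw [cat_apply]; rfl

lemma shift_periodic_mod (w : List ℕ) (k : ℕ) :
    shiftSeq (periodicSeq w) k = shiftSeq (periodicSeq w) (k % w.length) := by
  funext i
  simp [shiftSeq, periodicSeq]

lemma sandwich (u : List ℕ) (a b x : ℕ → ℕ) (h1 : altLe (cat u a) x) (h2 : altLe x (cat u b)) :
    ∃ x', x = cat u x' := by
  suffices H : ∀ (u : List ℕ) (a b x : ℕ → ℕ), altLe (cat u a) x → altLe x (cat u b) →
      ∃ x', x = cat u x' from H u a b x h1 h2
  intro u
  induction u with
  | nil => intro a b x _ _; exact ⟨x, rfl⟩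
  | cons c u ih =>
    intro a b x h1 h2
    rw [← cons_eta x] at h1 h2 ⊢
    rw [cat_cons, le_cons] at h1 h2
    have h3 : x 0 = c := by omega
    obtain ⟨x', hx⟩ := ih b a (shiftSeq x 1)
      (by rcases h2 with h2 | h2; · omega
          · exact h2.2)
      (by rcases h1 with h1 | h1; · omega
          · exact h1.2)
    exact ⟨x', by rw [cat_cons, h3, hx]⟩

/-! ### Systems and counting -/

lemma mem_sys {d x : ℕ → ℕ} : x ∈ LyndonSystem d ↔ ∀ k, altLe d (shiftSeq x k) := by
  refine ⟨fun h => h.2, fun h => ⟨fun i => ?_, h⟩⟩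
  simpa [shiftSeq] using le_head (h i)

lemma sys_shift {d x : ℕ → ℕ} (h : x ∈ LyndonSystem d) (k : ℕ) : shiftSeq x k ∈ LyndonSystem d := by
  rw [mem_sys] at *
  intro j; rw [shift_shift]; exact h _

lemma sys_le {d x : ℕ → ℕ} (h : x ∈ LyndonSystem d) : altLe d x := by
  simpa using mem_sys.1 h 0

lemma sys_cons {d x : ℕ → ℕ} {c : ℕ} (h : x ∈ LyndonSystem d) (hc : altLe d (cons c x)) :
    cons c x ∈ LyndonSystem d := by
  rw [mem_sys] at *
  intro k
  rcases k with _ | k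
  · simpa using hc
  · rw [shift_cons_succ]; exact h k

lemma sys_cat {d y : ℕ → ℕ} {u : List ℕ} (h : cat u y ∈ LyndonSystem d) : y ∈ LyndonSystem d := by
  have := sys_shift h u.length
  rwa [shift_cat_len] at this

lemma sys_mono {a b : ℕ → ℕ} (h : altLe a b) : LyndonSystem b ⊆ LyndonSystem a := by
  intro x hx
  rw [mem_sys] at *
  exact fun k => le_trans' h (hx k)

def Pfx (X : Set (ℕ → ℕ)) (N : ℕ) : Set (List ℕ) := (fun x => pre x N) '' X

lemma Hword_eq (d : ℕ → ℕ) (N : ℕ) : Hword d N = (Pfx (LyndonSystem d) N).ncard := by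
  unfold Hword
  congr 1
  ext w
  constructor
  · rintro ⟨⟨x, hx, k, hk⟩, rfl⟩
    exact ⟨shiftSeq x k, sys_shift hx k, hk.symm⟩
  · rintro ⟨x, hx, rfl⟩
    refine ⟨⟨x, hx, 0, ?_⟩, by simp⟩
    simp [pre]

lemma words_finite (D N : ℕ) : {u : List ℕ | u.length = N ∧ ∀ c ∈ u, c ≤ D}.Finite := by
  refine ((List.finite_length_eq (Fin (D + 1)) N).image (List.map (fun i : Fin (D + 1) => (i : ℕ)))).subset ?_
  rintro u ⟨h1, h2⟩
  refine ⟨u.attach.map (fun c => ⟨c.1, Nat.lt_succ_of_le (h2 c.1 c.2)⟩), by simpa using h1, ?_⟩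
  simp [List.map_map, Function.comp_def]

lemma Pfx_finite {d : ℕ → ℕ} {X : Set (ℕ → ℕ)} (hX : X ⊆ LyndonSystem d) (N : ℕ) :
    (Pfx X N).Finite := by
  refine (words_finite (d 0) N).subset ?_
  rintro _ ⟨x, hx, rfl⟩
  refine ⟨by simp, ?_⟩
  simp only [pre, List.mem_map]
  rintro c ⟨i, _, rfl⟩
  exact (hX hx).1 i

lemma ncard_le_sum {α ι : Type*} (s : Finset ι) (F : ι → Set α) (c : ι → ℕ) (X : Set α)
    (hX : X ⊆ ⋃ i ∈ s, F i) (hf : ∀ i ∈ s, (F i).Finite) (hc : ∀ i ∈ s, (F i).ncard ≤ c i) :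
    X.ncard ≤ ∑ i ∈ s, c i := by
  classical
  have hfin : ∀ s' ⊆ s, (⋃ i ∈ s', F i).Finite := fun s' hs' =>
    Set.Finite.biUnion s'.finite_toSet (fun i hi => hf i (hs' hi))
  refine (Set.ncard_le_ncard hX (hfin s subset_rfl)).trans ?_
  clear hX
  induction s using Finset.induction_on with
  | empty => simp
  | insert a s ha ih =>
    rw [Finset.sum_insert ha, Finset.set_biUnion_insert]
    refine (Set.ncard_union_le _ _).trans (add_le_add (hc a (by simp)) (ih ?_ ?_ ?_))
    · exact fun i hi => hf i (by simp [hi])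
    · exact fun i hi => hc i (by simp [hi])
    · exact fun s' hs' => hfin s' (hs'.trans (Finset.subset_insert _ _))

lemma Hword_mono_seq {a b : ℕ → ℕ} (h : altLe a b) (N : ℕ) : Hword b N ≤ Hword a N := by
  rw [Hword_eq, Hword_eq]
  exact Set.ncard_le_ncard (Set.image_mono (sys_mono h)) (Pfx_finite subset_rfl N)

lemma Hword_mono (d : ℕ → ℕ) : Monotone (Hword d) := by
  intro a b h
  rw [Hword_eq, Hword_eq]
  have : Pfx (LyndonSystem d) a ⊆ (List.take a) '' (Pfx (LyndonSystem d) b) := by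
    rintro _ ⟨x, hx, rfl⟩
    exact ⟨_, ⟨x, hx, rfl⟩, pre_take x h⟩
  exact (Set.ncard_le_ncard this ((Pfx_finite subset_rfl b).image _)).trans
    (Set.ncard_image_le (Pfx_finite subset_rfl b))

lemma Hword_pos {d : ℕ → ℕ} (h : IsAltLyndon d) (N : ℕ) : 1 ≤ Hword d N := by
  rw [Hword_eq, Nat.one_le_iff_ne_zero, ← Nat.pos_iff_ne_zero, Set.ncard_pos (Pfx_finite subset_rfl N)]
  exact ⟨_, d, mem_sys.2 h, rfl⟩

/-- Decomposition of the words of `M(P)` for `P ⪯ Q`, `Q` Lyndon. -/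
lemma main_count {P Q : ℕ → ℕ} (hQ : IsAltLyndon Q) (hPQ : altLe P Q) (N : ℕ) :
    Hword P N ≤ ∑ t ∈ Finset.range (N + 1),
      Hword Q t * (Pfx {x | x ∈ LyndonSystem P ∧ altLe x Q} (N - t)).ncard := by
  rw [Hword_eq]
  set X : Set (ℕ → ℕ) := {x | x ∈ LyndonSystem P ∧ altLe x Q} with hX
  have hXP : X ⊆ LyndonSystem P := fun x hx => hx.1
  have hQX : Q ∈ X := ⟨sys_mono hPQ (mem_sys.2 hQ), le_refl' Q⟩
  refine ncard_le_sum _ (fun t => (fun q : List ℕ × List ℕ => q.1 ++ q.2) ''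
    ((Pfx (LyndonSystem Q) t) ×ˢ (Pfx X (N - t)))) _ _ ?_ ?_ ?_
  · rintro _ ⟨x, hx, rfl⟩
    simp only [Set.mem_iUnion, Finset.mem_range]
    have key : ∀ t, (∀ k < t, altLe Q (shiftSeq x k)) → altLt (shiftSeq x t) Q →
        cat (pre x t) Q ∈ LyndonSystem Q := by
      intro t ht1 ht2
      rw [mem_sys]
      intro k
      rcases le_or_gt t k with hk | hk
      · obtain ⟨j, rfl⟩ := Nat.exists_eq_add_of_le hk
        rw [← shift_shift]
        have := shift_cat_len (pre x t) Q
        rw [pre_length] at this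
        rw [this]
        exact hQ j
      · rw [shift_cat _ _ _ (by simpa using hk.le)]
        set v := (pre x t).drop k with hv
        have h1 : altLe Q (cat v (shiftSeq x t)) := by
          have h := ht1 k hk
          rw [← cat_pre x t, shift_cat _ _ _ (by simpa using hk.le)] at h
          exact h
        rw [← cat_pre Q v.length] at h1
        have goal : altLe (cat (pre Q v.length) (shiftSeq Q v.length)) (cat v Q) := by
          by_cases hne : pre Q v.length = v
          · rw [hne] at h1 ⊢
            by_cases hev : Even v.length
            · rw [le_cat_even hev] at h1
              exact absurd (le_trans' (hQ v.length) h1) (not_le'.2 ht2)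
            · rw [le_cat_odd hev]
              exact hQ _
          · exact le_cat_ne _ _ (by simp) hne _ _ _ _ h1
        rwa [cat_pre] at goal
    by_cases hall : ∀ k, altLe Q (shiftSeq x k)
    · exact ⟨N, by omega, ⟨pre x N, []⟩, ⟨⟨x, mem_sys.2 hall, rfl⟩, ⟨Q, hQX, by simp⟩⟩, by simp⟩
    · push Not at hall
      classical
      let t := Nat.find hall
      have ht1 : ∀ k < t, altLe Q (shiftSeq x k) := fun k hk => not_not.1 (Nat.find_min hall hk)
      have ht2 : altLt (shiftSeq x t) Q := not_le'.1 (Nat.find_spec hall)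
      have hc := key t ht1 ht2
      rcases le_or_gt N t with h | h
      · refine ⟨N, by omega, ⟨pre x N, []⟩, ⟨⟨_, hc, ?_⟩, ⟨Q, hQX, by simp⟩⟩, by simp⟩
        simp only
        rw [pre_cat, pre_length, Nat.sub_eq_zero_of_le h, pre_zero, List.append_nil, pre_take x h]
      · refine ⟨t, by omega, ⟨pre x t, pre (shiftSeq x t) (N - t)⟩, ⟨⟨_, hc, ?_⟩,
          ⟨_, ⟨sys_shift hx t, Or.inr ht2⟩, rfl⟩⟩, ?_⟩
        · simp only
          have := pre_cat_len (pre x t) Q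
          rwa [pre_length] at this
        · simp only
          rw [← pre_add]; congr 1; omega
  · intro t _
    exact ((Pfx_finite subset_rfl t).prod (Pfx_finite hXP _)).image _
  · intro t _
    refine (Set.ncard_image_le ((Pfx_finite subset_rfl t).prod (Pfx_finite hXP _))).trans ?_
    rw [Set.ncard_prod, Hword_eq]

/-- recursion for prefix counts of block systems -/
lemma block_count {d : ℕ → ℕ} {X : Set (ℕ → ℕ)} (hX : X ⊆ LyndonSystem d) (A C : List ℕ)
    (n : ℕ) (hn : 1 ≤ n) (hA : n ≤ A.length) (hC : n ≤ C.length)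
    (h : ∀ x ∈ X, ∃ y ∈ X, x = cat A y ∨ x = cat C y) (m : ℕ) :
    (Pfx X m).ncard ≤ 2 ^ (m / n + 1) := by
  have h0 : (Pfx X 0).ncard ≤ 1 := by
    refine (Set.ncard_le_ncard (t := {[]}) ?_ (Set.finite_singleton _)).trans (by simp)
    rintro _ ⟨x, _, rfl⟩; simp
  induction m using Nat.strong_induction_on with
  | _ m ih =>
    rcases Nat.eq_zero_or_pos m with rfl | hm
    · exact h0.trans (by simp)
    have hsub : Pfx X m ⊆ ((fun z => (A ++ z).take m) '' Pfx X (m - A.length)) ∪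
        ((fun z => (C ++ z).take m) '' Pfx X (m - C.length)) := by
      rintro _ ⟨x, hx, rfl⟩
      obtain ⟨y, hy, rfl | rfl⟩ := h x hx
      · left; exact ⟨_, ⟨y, hy, rfl⟩, (pre_cat _ _ _).symm⟩
      · right; exact ⟨_, ⟨y, hy, rfl⟩, (pre_cat _ _ _).symm⟩
    have hb : ∀ l, n ≤ l → (Pfx X (m - l)).ncard ≤ 2 ^ (m / n) := by
      intro l hl
      rcases le_or_gt m l with h1 | h1
      · rw [Nat.sub_eq_zero_of_le h1]
        exact h0.trans Nat.one_le_two_pow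
      · refine (ih (m - l) (by omega)).trans (Nat.pow_le_pow_right (by norm_num) ?_)
        have h2 : (m - n) / n + 1 = m / n := by
          have := Nat.div_eq_sub_div (a := m) (b := n) (by omega) (by omega)
          omega
        have : (m - l) / n ≤ (m - n) / n := Nat.div_le_div_right (by omega)
        omega
    have hf := fun l => Pfx_finite hX (m - l)
    calc (Pfx X m).ncard ≤ _ := Set.ncard_le_ncard hsub (((hf _).image _).union ((hf _).image _))
      _ ≤ _ := Set.ncard_union_le _ _
      _ ≤ 2 ^ (m / n) + 2 ^ (m / n) := add_le_add
          ((Set.ncard_image_le (hf _)).trans (hb _ hA)) ((Set.ncard_image_le (hf _)).trans (hb _ hC))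
      _ = 2 ^ (m / n + 1) := by ring

lemma tail_count {d s : ℕ → ℕ} {X : Set (ℕ → ℕ)} (hX : X ⊆ LyndonSystem d) (A : List ℕ)
    (hA : 1 ≤ A.length)
    (h : ∀ x ∈ X, x = s ∨ ∃ y ∈ X, x = cat A y) (m : ℕ) :
    (Pfx X m).ncard ≤ m + 1 := by
  have h0 : (Pfx X 0).ncard ≤ 1 := by
    refine (Set.ncard_le_ncard (t := {[]}) ?_ (Set.finite_singleton _)).trans (by simp)
    rintro _ ⟨x, _, rfl⟩; simp
  induction m using Nat.strong_induction_on with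
  | _ m ih =>
    rcases Nat.eq_zero_or_pos m with rfl | hm
    · exact h0.trans (by simp)
    have hsub : Pfx X m ⊆ {pre s m} ∪ ((fun z => (A ++ z).take m) '' Pfx X (m - A.length)) := by
      rintro _ ⟨x, hx, rfl⟩
      obtain rfl | ⟨y, hy, rfl⟩ := h x hx
      · left; rfl
      · right; exact ⟨_, ⟨y, hy, rfl⟩, (pre_cat _ _ _).symm⟩
    have hf := fun l => Pfx_finite hX (m - l)
    have := ih (m - A.length) (by omega)
    calc (Pfx X m).ncard ≤ _ := Set.ncard_le_ncard hsub ((Set.finite_singleton _).union ((hf _).image _))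
      _ ≤ _ := Set.ncard_union_le _ _
      _ ≤ 1 + (m - A.length + 1) := add_le_add (by simp) ((Set.ncard_image_le (hf _)).trans this)
      _ ≤ m + 1 := by omega


/-! ### Deterministic automata -/
section Aut

variable {V : Type} (step : V → ℕ → V) (ok : V → ℕ → Prop)

def Valid (step : V → ℕ → V) (ok : V → ℕ → Prop) : V → List ℕ → Prop
  | _, [] => True
  | v, c :: u => ok v c ∧ Valid step ok (step v c) u

lemma valid_append (v : V) (u u' : List ℕ) :
    Valid step ok v (u ++ u') ↔ Valid step ok v u ∧ Valid step ok (u.foldl step v) u' := by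
  induction u generalizing v with
  | nil => simp [Valid]
  | cons c u ih => simp [Valid, ih, and_assoc]

def Wd (v : V) (N : ℕ) : Set (List ℕ) := {u | u.length = N ∧ Valid step ok v u}

variable {step ok}

lemma valid_bound {D : ℕ} (hD : ∀ v c, ok v c → c ≤ D) (v : V) (u : List ℕ)
    (h : Valid step ok v u) : ∀ c ∈ u, c ≤ D := by
  induction u generalizing v with
  | nil => simp
  | cons c u ih =>
    intro c' hc'
    rcases List.mem_cons.1 hc' with rfl | hc'
    · exact hD _ _ h.1
    · exact ih _ h.2 _ hc'

lemma Wd_finite {D : ℕ} (hD : ∀ v c, ok v c → c ≤ D) (v : V) (N : ℕ) :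
    (Wd step ok v N).Finite :=
  (words_finite D N).subset fun u hu => ⟨hu.1, valid_bound hD v u hu.2⟩

lemma shorten [Fintype V] (a b : V) (u : List ℕ) (hu : Valid step ok a u)
    (hb : u.foldl step a = b) :
    ∃ u', Valid step ok a u' ∧ u'.foldl step a = b ∧ u'.length < Fintype.card V := by
  classical
  induction hl : u.length using Nat.strong_induction_on generalizing u with
  | _ L ih =>
    subst hl
    rcases lt_or_ge u.length (Fintype.card V) with h | h
    · exact ⟨u, hu, hb, h⟩
    obtain ⟨i, j, hij, he⟩ := Fintype.exists_ne_map_eq_of_card_lt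
      (fun i : Fin (u.length + 1) => (u.take i).foldl step a) (by simpa using h)
    wlog hlt : i < j generalizing i j
    · exact this j i hij.symm he.symm (lt_of_le_of_ne (not_lt.1 hlt) hij.symm)
    have hj : (j : ℕ) ≤ u.length := by omega
    have hlt' : (i : ℕ) < j := hlt
    refine ih (u.take i ++ u.drop j).length ?_ (u.take i ++ u.drop j) ?_ ?_ rfl
    · simp; omega
    · rw [valid_append]
      have h1 := hu
      rw [← List.take_append_drop i u, valid_append] at h1
      have h2 := hu
      rw [← List.take_append_drop j u, valid_append] at h2
      exact ⟨h1.1, he ▸ h2.2⟩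
    · rw [List.foldl_append, he, ← List.foldl_append, List.take_append_drop, hb]

lemma two_loops {D n : ℕ} (hD : ∀ v c, ok v c → c ≤ D) (v : V) (c c' : ℕ) (u u' : List ℕ)
    (hcc : c ≠ c')
    (h : Valid step ok v (c :: u)) (h1 : (c :: u).foldl step v = v) (h2 : u.length + 1 ≤ n)
    (h' : Valid step ok v (c' :: u')) (h1' : (c' :: u').foldl step v = v)
    (h2' : u'.length + 1 ≤ n) (N : ℕ) :
    2 ^ (N / n) ≤ (Wd step ok v N).ncard := by
  have hne : ∀ N, (Wd step ok v N).Nonempty := by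
    intro N
    induction N using Nat.strong_induction_on with
    | _ N ih =>
      rcases Nat.eq_zero_or_pos N with rfl | hN
      · exact ⟨[], rfl, trivial⟩
      rcases le_or_gt N (u.length + 1) with hl | hl
      · refine ⟨(c :: u).take N, by simp; omega, ?_⟩
        rw [← List.take_append_drop N (c :: u), valid_append] at h
        exact h.1
      · obtain ⟨z, hz, hz'⟩ := ih (N - (u.length + 1)) (by omega)
        refine ⟨(c :: u) ++ z, by simp [hz]; omega, ?_⟩
        rw [valid_append, h1]; exact ⟨h, hz'⟩
  induction N using Nat.strong_induction_on with
  | _ N ih =>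
    rcases lt_or_ge N n with hN | hN
    · rw [Nat.div_eq_of_lt hN, pow_zero, Nat.one_le_iff_ne_zero, ← Nat.pos_iff_ne_zero,
        Set.ncard_pos (Wd_finite hD v N)]
      exact hne N
    have hb : ∀ l, 1 ≤ l → l ≤ n → 2 ^ (N / n - 1) ≤ (Wd step ok v (N - l)).ncard := by
      intro l hl hl'
      refine le_trans (Nat.pow_le_pow_right (by norm_num) ?_) (ih (N - l) (by omega))
      have h2 := Nat.div_eq_sub_div (a := N) (b := n) (by omega) (by omega)
      have : (N - n) / n ≤ (N - l) / n := Nat.div_le_div_right (by omega)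
      rw [h2, Nat.add_sub_cancel]
      exact this
    have hpos : 1 ≤ N / n := (Nat.one_le_div_iff (by omega)).2 hN
    have hsub : ((fun z => (c :: u) ++ z) '' Wd step ok v (N - (u.length + 1))) ∪
        ((fun z => (c' :: u') ++ z) '' Wd step ok v (N - (u'.length + 1))) ⊆ Wd step ok v N := by
      rintro _ (⟨z, ⟨hz, hz'⟩, rfl⟩ | ⟨z, ⟨hz, hz'⟩, rfl⟩)
      · refine ⟨by simp [hz]; omega, ?_⟩
        simp only
        rw [valid_append, h1]; exact ⟨h, hz'⟩
      · refine ⟨by simp [hz]; omega, ?_⟩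
        simp only
        rw [valid_append, h1']; exact ⟨h', hz'⟩
    have hdis : Disjoint ((fun z => (c :: u) ++ z) '' Wd step ok v (N - (u.length + 1)))
        ((fun z => (c' :: u') ++ z) '' Wd step ok v (N - (u'.length + 1))) := by
      rw [Set.disjoint_left]
      rintro _ ⟨z, _, rfl⟩ ⟨z', _, he⟩
      simp at he
      exact hcc he.1.symm
    calc 2 ^ (N / n) = 2 ^ (N / n - 1) + 2 ^ (N / n - 1) := by
          rw [← two_mul, ← pow_succ']; congr 1; omega
      _ ≤ (Wd step ok v (N - (u.length + 1))).ncard + (Wd step ok v (N - (u'.length + 1))).ncard :=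
          add_le_add (hb _ (by omega) h2) (hb _ (by omega) h2')
      _ = _ := by
          rw [Set.ncard_union_eq hdis ((Wd_finite hD _ _).image _) ((Wd_finite hD _ _).image _),
            Set.ncard_image_of_injective _ (List.append_right_injective _),
            Set.ncard_image_of_injective _ (List.append_right_injective _)]
      _ ≤ _ := Set.ncard_le_ncard hsub (Wd_finite hD _ _)

lemma uniq_poly [Fintype V] {D : ℕ} (hD : ∀ v c, ok v c → c ≤ D)
    (huniq : ∀ v c c' u u', Valid step ok v (c :: u) → (c :: u).foldl step v = v →
      Valid step ok v (c' :: u') → (c' :: u').foldl step v = v → c = c')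
    (v : V) (N : ℕ) :
    (Wd step ok v N).ncard ≤ ((N + 1) * (D + 1)) ^ Fintype.card V := by
  classical
  have hex : ∀ u ∈ Wd step ok v N, ∃ e : V → Fin (N + 1) × Fin (D + 1), ∀ s t, t < N →
      (u.take t).foldl step v = s → t ≤ (e s).1 ∧ (t = (e s).1 → u.getD t 0 = (e s).2) ∧
      (t < (e s).1 → (u.take (e s).1).foldl step v = s) ∧ ((e s).1 : ℕ) < N := by
    rintro u ⟨hu, huv⟩
    have : ∀ s : V, ∃ q : Fin (N + 1) × Fin (D + 1), ∀ t, t < N →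
      (u.take t).foldl step v = s → t ≤ q.1 ∧ (t = q.1 → u.getD t 0 = q.2) ∧
      (t < q.1 → (u.take q.1).foldl step v = s) ∧ (q.1 : ℕ) < N := by
      intro s
      let F := (Finset.range N).filter (fun t => (u.take t).foldl step v = s)
      rcases F.eq_empty_or_nonempty with hF | hF
      · refine ⟨⟨0, 0⟩, fun t ht hts => ?_⟩
        have : t ∈ F := by simp [F, ht, hts]
        simp [hF] at this
      · have hm := F.max'_mem hF
        set m := F.max' hF with hmdef
        have hm' : m < N ∧ (u.take m).foldl step v = s := by simpa [F] using hm
        have hmem : u.getD m 0 ≤ D := by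
          refine valid_bound hD v u huv _ ?_
          rw [List.getD_eq_getElem _ _ (by omega)]
          exact List.getElem_mem _
        refine ⟨⟨⟨m, by omega⟩, ⟨u.getD m 0, by omega⟩⟩, fun t ht hts => ⟨?_, ?_, ?_, ?_⟩⟩
        · exact F.le_max' t (by simp [F, ht, hts])
        · intro h; simp only at h; simp [h]
        · intro _; exact hm'.2
        · exact hm'.1
    choose e he using this
    exact ⟨e, fun s t => he s t⟩
  choose! e he using hex
  have hinj : Set.InjOn e (Wd step ok v N) := by
    intro u hu u' hu' hee
    have key : ∀ t ≤ N, u.take t = u'.take t := by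
      intro t
      induction t with
      | zero => simp
      | succ t ih =>
        intro ht
        have iht := ih (by omega)
        have l1 : t < u.length := by rw [hu.1]; omega
        have l2 : t < u'.length := by rw [hu'.1]; omega
        set s := (u.take t).foldl step v with hs
        obtain ⟨a1, a2, a3, a4⟩ := he u hu s t (by omega) rfl
        obtain ⟨b1, b2, b3, b4⟩ := he u' hu' s t (by omega) (by rw [← iht])
        rw [← hee] at b1 b2 b3
        have hc : u[t] = u'[t] := by
          rw [List.getD_eq_getElem _ _ l1] at a2
          rw [List.getD_eq_getElem _ _ l2] at b2
          rcases a1.eq_or_lt with h | h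
          · rw [a2 h, b2 h]
          · have loop : ∀ (z : List ℕ) (m : ℕ) (hz : t < z.length), Valid step ok v z → t < m → m < N → z.length = N →
                (z.take t).foldl step v = s → (z.take m).foldl step v = s →
                ∃ r, Valid step ok s (z[t] :: r) ∧ (z[t] :: r).foldl step s = s := by
              intro z m hz hv htm hmN hzN e1 e2
              have hsplit : z.take m = z.take t ++ (z[t] :: (z.take m).drop (t + 1)) := by
                have : z[t] = (z.take m)[t]'(by simp; omega) := by simp
                rw [this, ← List.drop_eq_getElem_cons]
                conv_lhs => rw [← List.take_append_drop t (z.take m)]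
                rw [List.take_take, min_eq_left htm.le]
              refine ⟨(z.take m).drop (t + 1), ?_, ?_⟩
              · rw [← List.take_append_drop m z, valid_append, hsplit, valid_append, e1] at hv
                exact hv.1.2
              · rw [hsplit, List.foldl_append, e1] at e2
                exact e2
            obtain ⟨r, hr1, hr2⟩ := loop u _ l1 hu.2 h a4 hu.1 rfl (a3 h)
            obtain ⟨r', hr1', hr2'⟩ := loop u' _ l2 hu'.2 h a4 hu'.1 (by rw [← iht]) (b3 h)
            exact huniq s _ _ _ _ hr1 hr2 hr1' hr2'
        rw [List.take_succ_eq_append_getElem l1, List.take_succ_eq_append_getElem l2, iht, hc]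
    have := key N le_rfl
    rwa [List.take_of_length_le hu.1.le, List.take_of_length_le hu'.1.le] at this
  calc (Wd step ok v N).ncard ≤ (Set.univ : Set (V → Fin (N + 1) × Fin (D + 1))).ncard :=
        Set.ncard_le_ncard_of_injOn e (by simp) hinj Set.finite_univ
    _ = _ := by rw [Set.ncard_univ, Nat.card_eq_fintype_card]; simp

lemma dichotomy [Fintype V] {D n : ℕ} (hD : ∀ v c, ok v c → c ≤ D) (hn : Fintype.card V ≤ n) :
    (∃ v : V, ∀ N, 2 ^ (N / n) ≤ (Wd step ok v N).ncard) ∨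
    (∀ (v : V) N, (Wd step ok v N).ncard ≤ ((N + 1) * (D + 1)) ^ n) := by
  by_cases huniq : (∀ v c c' u u', Valid step ok v (c :: u) → (c :: u).foldl step v = v →
      Valid step ok v (c' :: u') → (c' :: u').foldl step v = v → c = c')
  · right
    intro v N
    exact (uniq_poly hD huniq v N).trans (Nat.pow_le_pow_right (by positivity) hn)
  · left
    push Not at huniq
    obtain ⟨v, c, c', u, u', h1, h2, h3, h4, h5⟩ := huniq
    obtain ⟨z, z1, z2, z3⟩ := shorten (step v c) v u h1.2 h2
    obtain ⟨z', z1', z2', z3'⟩ := shorten (step v c') v u' h3.2 h4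
    exact ⟨v, fun N => two_loops hD v c c' z z' h5 ⟨h1.1, z1⟩ z2 (by omega) ⟨h3.1, z1'⟩ z2'
      (by omega) N⟩

end Aut


/-! ### The automaton of a periodic Lyndon word -/
section LB

variable (p : ℕ → ℕ) (n : ℕ) [NeZero n]

open Classical in
noncomputable def st (b : Bool) (y : ℕ → ℕ) : Finset (Fin n) :=
  Finset.univ.filter fun j => if b then altLe (shiftSeq p j) y else altLt (shiftSeq p j) y

noncomputable def stp (S : Finset (Fin n)) (c : ℕ) : Finset (Fin n) :=
  Finset.univ.filter fun j => c < p j ∨ (c = p j ∧ (j + 1) ∉ S)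

variable {p n}

lemma shift_fin_succ (hp : shiftSeq p n = p) (j : Fin n) :
    shiftSeq p ((j + 1 : Fin n) : ℕ) = shiftSeq p ((j : ℕ) + 1) := by
  have hmod : ∀ m, shiftSeq p m = shiftSeq p (m % n) := by
    intro m
    induction m using Nat.strong_induction_on with
    | _ m ih =>
      rcases lt_or_ge m n with h | h
      · rw [Nat.mod_eq_of_lt h]
      · have hn : 0 < n := Nat.pos_of_ne_zero (NeZero.ne n)
        have h2 := ih (m - n) (by omega)
        rw [← Nat.mod_eq_sub_mod h] at h2
        rw [← h2]
        obtain ⟨k, rfl⟩ := Nat.exists_eq_add_of_le h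
        rw [← shift_shift, hp, Nat.add_sub_cancel_left]
  rw [hmod (j + 1), Fin.val_add]
  congr 1
  simp

lemma mem_st (b : Bool) (y : ℕ → ℕ) (j : Fin n) : j ∈ st p n b y ↔
    if b then altLe (shiftSeq p j) y else altLt (shiftSeq p j) y := by
  simp [st]

lemma mem_stp (S : Finset (Fin n)) (c : ℕ) (j : Fin n) : j ∈ stp p n S c ↔
    c < p j ∨ (c = p j ∧ (j + 1) ∉ S) := by
  simp [stp]

lemma stp_st (hp : shiftSeq p n = p) (b : Bool) (c : ℕ) (y : ℕ → ℕ) :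
    stp p n (st p n b y) c = st p n (!b) (cons c y) := by
  ext j
  have hj : shiftSeq p j = cons (p j) (shiftSeq p ((j + 1 : Fin n) : ℕ)) := by
    rw [shift_fin_succ hp, ← shift_shift]
    exact (cons_eta _).symm
  rw [mem_stp, mem_st, mem_st, hj, le_cons, lt_cons]
  cases b
  · simp [not_lt', eq_comm]
  · simp [not_le', eq_comm]

lemma st_zero_mem (y : ℕ → ℕ) (b : Bool) :
    (0 : Fin n) ∈ st p n b y ↔ if b then altLe p y else altLt p y := by
  simp [st]

lemma st_chain (b b' : Bool) (y y' : ℕ → ℕ) :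
    st p n b y ⊆ st p n b' y' ∨ st p n b' y' ⊆ st p n b y := by
  by_contra h
  rw [not_or, Finset.not_subset, Finset.not_subset] at h
  obtain ⟨⟨i, hi, hi'⟩, ⟨j, hj, hj'⟩⟩ := h
  rw [mem_st] at hi hi' hj hj'
  cases b <;> cases b' <;> simp [altLe_iff, altLt_iff, -not_lt, -not_le] at hi hi' hj hj' <;>
    order

variable (p n)
def VS : Type := {S : Finset (Fin n) // 0 ∈ S ∧ ∃ b, ∃ y ∈ LyndonSystem p, S = st p n b y}

noncomputable instance : Fintype (VS p n) := by
  classical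
  unfold VS
  exact Fintype.ofInjective (fun S => S.1) Subtype.val_injective

variable {p n}

lemma card_VS : Fintype.card (VS p n) ≤ n := by
  have : Function.Injective (fun v : VS p n =>
      (⟨v.1.card - 1, by
        have h1 : 0 < v.1.card := Finset.card_pos.2 ⟨0, v.2.1⟩
        have h2 := Finset.card_le_univ v.1
        simp at h2
        omega⟩ : Fin n)) := by
    rintro ⟨S, h0, b, y, hy, rfl⟩ ⟨S', h0', b', y', hy', rfl⟩ he
    simp only [Fin.mk.injEq] at he
    have h1 : 0 < (st p n b y).card := Finset.card_pos.2 ⟨0, h0⟩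
    have h2 : 0 < (st p n b' y').card := Finset.card_pos.2 ⟨0, h0'⟩
    have h3 : (st p n b y).card = (st p n b' y').card := by omega
    apply Subtype.ext
    rcases st_chain (p := p) (n := n) b b' y y' with h | h
    · exact Finset.eq_of_subset_of_card_le h h3.ge
    · exact (Finset.eq_of_subset_of_card_le h h3.le).symm
  simpa using Fintype.card_le_of_injective _ this

variable (p n)
def okV (v : VS p n) (c : ℕ) : Prop := 0 ∈ stp p n v.1 c

lemma okV_le (v : VS p n) (c : ℕ) (h : okV p n v c) : c ≤ p 0 := by
  simp [okV, stp] at h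
  omega

lemma stp_mem (hp : shiftSeq p n = p) (v : VS p n) (c : ℕ) (h : okV p n v c) :
    0 ∈ stp p n v.1 c ∧ ∃ b, ∃ y ∈ LyndonSystem p, stp p n v.1 c = st p n b y := by
  refine ⟨h, ?_⟩
  obtain ⟨b, y, hy, he⟩ := v.2.2
  refine ⟨!b, cons c y, ?_, ?_⟩
  · refine sys_cons hy ?_
    unfold okV at h
    rw [he, stp_st hp, st_zero_mem] at h
    cases b
    · simpa using h
    · exact Or.inr (by simpa using h)
  · rw [he, stp_st hp]

open Classical in
noncomputable def stepV (hp : shiftSeq p n = p) (v : VS p n) (c : ℕ) : VS p n :=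
  if h : okV p n v c then ⟨stp p n v.1 c, stp_mem p n hp v c h⟩ else v

variable {p n}

lemma valid_mem (hp : shiftSeq p n = p) (u : List ℕ) : ∀ (v : VS p n) (b : Bool) (y : ℕ → ℕ),
    y ∈ LyndonSystem p → v.1 = st p n b y → Valid (stepV p n hp) (okV p n) v u →
    cat u.reverse y ∈ LyndonSystem p := by
  induction u with
  | nil => intro v b y hy _ _; simpa using hy
  | cons c u ih =>
    intro v b y hy he hv
    rw [List.reverse_cons, cat_append]
    have hok := hv.1
    refine ih (stepV p n hp v c) (!b) (cons c y) ?_ ?_ hv.2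
    · refine sys_cons hy ?_
      unfold okV at hok
      rw [he, stp_st hp, st_zero_mem] at hok
      cases b
      · simpa using hok
      · exact Or.inr (by simpa using hok)
    · simp [stepV, hok, he, stp_st hp]

lemma mem_valid (hp : shiftSeq p n = p) (u : List ℕ) : ∀ (v : VS p n) (b : Bool) (y : ℕ → ℕ),
    v.1 = st p n b y →
    (∀ k < u.length, altLt p (shiftSeq (cat u.reverse y) k)) →
    Valid (stepV p n hp) (okV p n) v u := by
  induction u with
  | nil => intro v b y _ _; trivial
  | cons c u ih =>
    intro v b y he hk
    rw [List.reverse_cons, cat_append] at hk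
    have hlast := hk u.length (by simp)
    have h2 := shift_cat_len u.reverse (cat [c] y)
    rw [List.length_reverse] at h2
    rw [h2] at hlast
    have hok : okV p n v c := by
      unfold okV
      rw [he, stp_st hp, st_zero_mem]
      cases b
      · exact Or.inr (by simpa using hlast)
      · simpa using hlast
    refine ⟨hok, ih _ (!b) (cons c y) ?_ ?_⟩
    · simp [stepV, hok, he, stp_st hp]
    · intro k hk'
      exact hk k (by simp; omega)

lemma Hword_ge (hp : shiftSeq p n = p) (v : VS p n) (N : ℕ) :
    (Wd (stepV p n hp) (okV p n) v N).ncard ≤ Hword p N := by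
  obtain ⟨b, y, hy, he⟩ := v.2.2
  rw [Hword_eq]
  refine Set.ncard_le_ncard_of_injOn List.reverse ?_ List.reverse_injective.injOn
    (Pfx_finite subset_rfl N)
  rintro u ⟨hu, huv⟩
  refine ⟨_, valid_mem hp u v b y hy he huv, ?_⟩
  have := pre_cat_len u.reverse y
  rwa [List.length_reverse, hu] at this

lemma Hword_le_poly (hl : IsAltLyndon p) (hp : shiftSeq p n = p) (D : ℕ)
    (h : ∀ (v : VS p n) N, (Wd (stepV p n hp) (okV p n) v N).ncard ≤ ((N + 1) * (D + 1)) ^ n)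
    (N : ℕ) : Hword p N ≤ (N + 1 + n) * ((N + 1) * (D + 1)) ^ n := by
  classical
  have hfin := fun v N => Wd_finite (step := stepV p n hp) (okV_le p n) v N
  have hpm : p ∈ LyndonSystem p := mem_sys.2 hl
  let vo : VS p n := ⟨st p n true p, by rw [st_zero_mem]; simp [le_refl'], true, p, hpm, rfl⟩
  let F : VS p n ⊕ Fin (N + 1) → Set (List ℕ) := fun i => match i with
    | Sum.inl v => List.reverse '' Wd (stepV p n hp) (okV p n) v N
    | Sum.inr t => (fun u : List ℕ => u.reverse ++ pre p (N - t)) ''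
        Wd (stepV p n hp) (okV p n) vo t
  have hF : ∀ i, (F i).Finite := by
    rintro (v | t)
    · exact (hfin _ _).image _
    · exact (hfin _ _).image _
  have hF' : ∀ i, (F i).ncard ≤ ((N + 1) * (D + 1)) ^ n := by
    rintro (v | t)
    · exact (Set.ncard_image_le (hfin _ _)).trans (h _ _)
    · refine (Set.ncard_image_le (hfin _ _)).trans ((h _ _).trans ?_)
      have := t.2
      gcongr
      omega
  rw [Hword_eq]
  have := ncard_le_sum Finset.univ F (fun _ => ((N + 1) * (D + 1)) ^ n)
    (Pfx (LyndonSystem p) N) ?_ (fun i _ => hF i) (fun i _ => hF' i)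
  · refine this.trans ?_
    rw [Finset.sum_const, Finset.card_univ, smul_eq_mul, Fintype.card_sum, Fintype.card_fin]
    have h3 := card_VS (p := p) (n := n)
    exact Nat.mul_le_mul_right _ (by omega)
  · rintro _ ⟨x, hx, rfl⟩
    simp only [Set.mem_iUnion, Finset.mem_univ, exists_prop, true_and]
    have hx' := mem_sys.1 hx
    by_cases hex : ∃ t, shiftSeq x t = p ∧ t ≤ N
    · let t := Nat.find hex
      obtain ⟨ht1, ht2⟩ := Nat.find_spec hex
      have ht3 : ∀ k < t, shiftSeq x k ≠ p := by
        intro k hk he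
        exact Nat.find_min hex hk ⟨he, by omega⟩
      change shiftSeq x t = p at ht1
      change t ≤ N at ht2
      refine ⟨Sum.inr ⟨t, by omega⟩, (pre x t).reverse, ⟨by simp, ?_⟩, ?_⟩
      · refine mem_valid hp _ vo true p rfl ?_
        intro k hk
        rw [List.reverse_reverse]
        have : cat (pre x t) p = x := by rw [← ht1]; exact cat_pre x t
        rw [this]
        exact lt_of_le_of_ne' (hx' k) (ht3 k (by simpa using hk)).symm
      · simp only [List.reverse_reverse]
        rw [← ht1, ← pre_add]
        congr 1; omega
    · push Not at hex
      let v : VS p n := ⟨st p n true (shiftSeq x N), by rw [st_zero_mem]; simp [hx'], true,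
        _, sys_shift hx N, rfl⟩
      refine ⟨Sum.inl v, (pre x N).reverse, ⟨by simp, ?_⟩, by simp⟩
      refine mem_valid hp _ v true _ rfl ?_
      intro k hk
      rw [List.reverse_reverse, cat_pre]
      refine lt_of_le_of_ne' (hx' k) (fun he => ?_)
      have := hex k he.symm
      simp at hk
      omega

lemma dich (hl : IsAltLyndon p) (hp : shiftSeq p n = p) :
    (∀ N, 2 ^ (N / n) ≤ Hword p N) ∨
    (∀ N, Hword p N ≤ (N + 1 + n) * ((N + 1) * (p 0 + 1)) ^ n) := by
  rcases dichotomy (step := stepV p n hp) (okV_le p n) card_VS with ⟨v, h⟩ | h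
  · left
    exact fun N => (h N).trans (Hword_ge hp v N)
  · right
    exact Hword_le_poly hl hp _ h

end LB

/-! ### Analysis -/

lemma tendsto_small (c k : ℝ) :
    Tendsto (fun N : ℕ => (c + k * Real.log ((N : ℝ) + 1)) / N) atTop (𝓝 0) := by
  have h1 : Tendsto (fun N : ℕ => Real.log ((N : ℝ) + 1) / N) atTop (𝓝 0) := by
    have h := (Real.tendsto_pow_log_div_mul_add_atTop 1 (-1) 1 one_ne_zero).comp
      (tendsto_atTop_add_const_right atTop (1 : ℝ) tendsto_natCast_atTop_atTop)
    refine h.congr fun N => ?_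
    simp
  have h2 : Tendsto (fun N : ℕ => c / (N : ℝ)) atTop (𝓝 0) :=
    tendsto_const_div_atTop_nhds_zero_nat c
  have h3 := h2.add (h1.const_mul k)
  simp only [mul_zero, add_zero] at h3
  refine h3.congr fun N => ?_
  ring

lemma squeeze_poly {f g : ℕ → ℕ} {L : ℝ} {K : ℝ} {k : ℕ} (hK : 0 < K) (hf : ∀ N, 1 ≤ f N)
    (h1 : ∀ N, f N ≤ g N) (h2 : ∀ N, (g N : ℝ) ≤ K * ((N : ℝ) + 1) ^ k * f N)
    (hL : Tendsto (fun N : ℕ => Real.log (f N) / N) atTop (𝓝 L)) :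
    Tendsto (fun N : ℕ => Real.log (g N) / N) atTop (𝓝 L) := by
  have h3 := (tendsto_small (Real.log K) k).add hL
  rw [zero_add] at h3
  refine tendsto_of_tendsto_of_tendsto_of_le_of_le hL h3 (fun N => ?_) (fun N => ?_)
  · have : (0 : ℝ) < f N := by exact_mod_cast hf N
    have h4 : (f N : ℝ) ≤ g N := by exact_mod_cast h1 N
    simp only
    gcongr
  · have h0 : (0 : ℝ) < f N := by exact_mod_cast hf N
    have h4 : (0 : ℝ) < g N := by exact_mod_cast (hf N).trans (h1 N)
    have h5 : Real.log (g N) ≤ (Real.log K + k * Real.log ((N : ℝ) + 1)) + Real.log (f N) := by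
      rw [← Real.log_pow, ← Real.log_mul hK.ne' (by positivity),
        ← Real.log_mul (by positivity) h0.ne']
      exact Real.log_le_log h4 (h2 N)
    simp only
    rw [← add_div]
    gcongr

lemma entropy_poly {f : ℕ → ℕ} {K : ℝ} {k : ℕ} (hK : 0 < K) (hf : ∀ N, 1 ≤ f N)
    (h2 : ∀ N, (f N : ℝ) ≤ K * ((N : ℝ) + 1) ^ k) :
    Tendsto (fun N : ℕ => Real.log (f N) / N) atTop (𝓝 0) := by
  refine squeeze_poly (f := fun _ => 1) (k := k) hK (fun _ => le_rfl) hf ?_ ?_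
  · simpa using h2
  · simp

lemma entropy_lb {f : ℕ → ℕ} {n : ℕ} {L : ℝ} (hn : 1 ≤ n) (h : ∀ N, 2 ^ (N / n) ≤ f N)
    (hL : Tendsto (fun N : ℕ => Real.log (f N) / N) atTop (𝓝 L)) : Real.log 2 / n ≤ L := by
  have h1 : Tendsto (fun m : ℕ => n * m) atTop atTop := by
    exact tendsto_id.const_mul_atTop' (by omega)
  refine ge_of_tendsto (hL.comp h1) ?_
  filter_upwards [eventually_ge_atTop 1] with m hm
  have h2 := h (n * m)
  rw [Nat.mul_div_cancel_left _ (by omega)] at h2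
  have h3 : (2 : ℝ) ^ m ≤ f (n * m) := by exact_mod_cast h2
  have h4 := Real.log_le_log (by positivity) h3
  rw [Real.log_pow] at h4
  have hn' : (0 : ℝ) < n := by exact_mod_cast hn
  have hm' : (0 : ℝ) < m := by exact_mod_cast hm
  simp only [Function.comp]
  rw [div_le_div_iff₀ hn' (by push_cast; positivity)]
  push_cast
  nlinarith

lemma entropy_final {f g : ℕ → ℕ} {n : ℕ} {L : ℝ} (hn : 1 ≤ n) (hnL : Real.log 2 / n ≤ L)
    (hf : ∀ N, 1 ≤ f N) (h1 : ∀ N, f N ≤ g N)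
    (h2 : ∀ N, g N ≤ ∑ t ∈ Finset.range (N + 1), f t * 2 ^ ((N - t) / n + 1))
    (hL : Tendsto (fun N : ℕ => Real.log (f N) / N) atTop (𝓝 L)) :
    Tendsto (fun N : ℕ => Real.log (g N) / N) atTop (𝓝 L) := by
  have hlow : ∀ N, Real.log (f N) / N ≤ Real.log (g N) / N := by
    intro N
    have : (0 : ℝ) < f N := by exact_mod_cast hf N
    have h4 : (f N : ℝ) ≤ g N := by exact_mod_cast h1 N
    gcongr
  rw [tendsto_order]
  constructor
  · intro a ha
    filter_upwards [(tendsto_order.1 hL).1 a ha] with N hN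
    exact hN.trans_le (hlow N)
  · intro a ha
    obtain ⟨L', hL1, hL2⟩ := exists_between ha
    have hL0 : 0 ≤ L' := by
      have : 0 ≤ Real.log 2 / n := div_nonneg (Real.log_nonneg (by norm_num)) (by positivity)
      linarith
    obtain ⟨N0, hN0⟩ := eventually_atTop.1 ((tendsto_order.1 hL).2 L' hL1)
    obtain ⟨C, hC1, hC⟩ : ∃ C : ℝ, 0 < C ∧ ∀ t, (f t : ℝ) ≤ C * Real.exp (L' * t) := by
      refine ⟨1 + ∑ t ∈ Finset.range (N0 + 1), (f t : ℝ), by positivity, fun t => ?_⟩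
      have hS : 0 ≤ ∑ t ∈ Finset.range (N0 + 1), (f t : ℝ) := by positivity
      have hexp : 1 ≤ Real.exp (L' * t) := Real.one_le_exp (by positivity)
      rcases lt_or_ge t (N0 + 1) with h | h
      · have h3 : (f t : ℝ) ≤ ∑ t ∈ Finset.range (N0 + 1), (f t : ℝ) :=
          Finset.single_le_sum (f := fun t => (f t : ℝ)) (fun i _ => by positivity)
            (Finset.mem_range.2 h)
        nlinarith
      · have h3 := hN0 t (by omega)
        have ht : (0 : ℝ) < t := by exact_mod_cast (by omega : 0 < t)
        have h0 : (0 : ℝ) < f t := by exact_mod_cast hf t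
        rw [div_lt_iff₀ ht] at h3
        have h4 : (f t : ℝ) ≤ Real.exp (L' * t) := by
          rw [← Real.log_le_iff_le_exp h0]; exact h3.le
        nlinarith
    have hn' : (0 : ℝ) < n := by exact_mod_cast hn
    have h2exp : ∀ m : ℕ, ((2 : ℝ) ^ (m / n + 1)) ≤ 2 * Real.exp (L' * m) := by
      intro m
      rw [pow_succ, mul_comm]
      gcongr
      have : (2 : ℝ) ^ (m / n) = Real.exp (Real.log 2 * ((m / n : ℕ) : ℝ)) := by
        rw [mul_comm, Real.exp_nat_mul, Real.exp_log (by norm_num)]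
      rw [this]
      apply Real.exp_le_exp.2
      have h5 : ((m / n : ℕ) : ℝ) ≤ m / n := Nat.cast_div_le
      have h6 : 0 ≤ Real.log 2 := Real.log_nonneg (by norm_num)
      calc Real.log 2 * ((m / n : ℕ) : ℝ) ≤ Real.log 2 * (m / n) := by gcongr
        _ = (Real.log 2 / n) * m := by ring
        _ ≤ L' * m := by gcongr; linarith
    have hg : ∀ N : ℕ, (g N : ℝ) ≤ (2 * C) * ((N : ℝ) + 1) * Real.exp (L' * N) := by
      intro N
      have h3 : (g N : ℝ) ≤ ∑ t ∈ Finset.range (N + 1), (f t : ℝ) * 2 ^ ((N - t) / n + 1) := by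
        exact_mod_cast h2 N
      refine h3.trans ?_
      calc ∑ t ∈ Finset.range (N + 1), (f t : ℝ) * 2 ^ ((N - t) / n + 1)
          ≤ ∑ t ∈ Finset.range (N + 1), 2 * C * Real.exp (L' * N) := by
            refine Finset.sum_le_sum fun t ht => ?_
            have ht' : t ≤ N := by simp at ht; omega
            have h7 := mul_le_mul (hC t) (h2exp (N - t)) (by positivity) (by positivity)
            refine h7.trans (le_of_eq ?_)
            rw [show L' * (N : ℝ) = L' * t + L' * ((N - t : ℕ) : ℝ) by
              rw [Nat.cast_sub ht']; ring, Real.exp_add]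
            ring
        _ = _ := by
            rw [Finset.sum_const, Finset.card_range, nsmul_eq_mul]; push_cast; ring
    have h3 := (tendsto_small (Real.log (2 * C)) 1).add_const L'
    rw [zero_add] at h3
    filter_upwards [(tendsto_order.1 h3).2 a hL2, eventually_ge_atTop 1] with N hN hN1
    refine lt_of_le_of_lt ?_ hN
    have hN' : (0 : ℝ) < N := by exact_mod_cast hN1
    have h4 : (0 : ℝ) < g N := by exact_mod_cast (hf N).trans (h1 N)
    have h5 := Real.log_le_log h4 (hg N)
    rw [Real.log_mul (by positivity) (by positivity), Real.log_mul (by positivity) (by positivity),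
      Real.log_exp] at h5
    rw [div_add' _ _ _ hN'.ne']
    gcongr
    linarith

lemma lower_bound (w : List ℕ) (hw : 1 ≤ w.length) (hl : IsAltLyndon (periodicSeq w)) {L : ℝ}
    (hL0 : 0 < L) (hL : EntropyIs (periodicSeq w) L) : Real.log 2 / w.length ≤ L := by
  haveI : NeZero w.length := ⟨by omega⟩
  have hp : shiftSeq (periodicSeq w) w.length = periodicSeq w := by
    rw [shift_periodic_mod]; simp
  rcases dich hl hp with h | h
  · exact entropy_lb hw h hL
  · exfalso
    have h0 : Tendsto (fun N : ℕ => Real.log (Hword (periodicSeq w) N) / N) atTop (𝓝 0) := by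
      refine entropy_poly (K := ((w.length + 1 : ℕ) : ℝ) * ((periodicSeq w 0 + 1 : ℕ) : ℝ) ^ w.length)
        (k := w.length + 1) (by positivity) (Hword_pos hl) (fun N => ?_)
      have h1 : Hword (periodicSeq w) N ≤ ((w.length + 1) * (periodicSeq w 0 + 1) ^ w.length) *
          (N + 1) ^ (w.length + 1) := by
        refine (h N).trans ?_
        calc (N + 1 + w.length) * ((N + 1) * (periodicSeq w 0 + 1)) ^ w.length
            ≤ ((w.length + 1) * (N + 1)) * ((N + 1) * (periodicSeq w 0 + 1)) ^ w.length := by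
              apply Nat.mul_le_mul_right; nlinarith
          _ = _ := by rw [mul_pow]; ring
      exact_mod_cast h1
    exact hL0.ne (tendsto_nhds_unique h0 hL)

/-! ### The specific words -/

lemma squeeze_poly_rev {f g : ℕ → ℕ} {L : ℝ} {K : ℝ} {k : ℕ} (hK : 0 < K) (hf : ∀ N, 1 ≤ f N)
    (h1 : ∀ N, f N ≤ g N) (h2 : ∀ N, (g N : ℝ) ≤ K * ((N : ℝ) + 1) ^ k * f N)
    (hL : Tendsto (fun N : ℕ => Real.log (g N) / N) atTop (𝓝 L)) :
    Tendsto (fun N : ℕ => Real.log (f N) / N) atTop (𝓝 L) := by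
  have h3 := hL.sub (tendsto_small (Real.log K) k)
  rw [sub_zero] at h3
  refine tendsto_of_tendsto_of_tendsto_of_le_of_le h3 hL (fun N => ?_) (fun N => ?_)
  · have h0 : (0 : ℝ) < f N := by exact_mod_cast hf N
    have h4 : (0 : ℝ) < g N := by exact_mod_cast (hf N).trans (h1 N)
    have h5 : Real.log (g N) ≤ (Real.log K + k * Real.log ((N : ℝ) + 1)) + Real.log (f N) := by
      rw [← Real.log_pow, ← Real.log_mul hK.ne' (by positivity),
        ← Real.log_mul (by positivity) h0.ne']
      exact Real.log_le_log h4 (h2 N)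
    simp only
    rw [← sub_div]
    gcongr
    linarith
  · have : (0 : ℝ) < f N := by exact_mod_cast hf N
    have h4 : (f N : ℝ) ≤ g N := by exact_mod_cast h1 N
    simp only
    gcongr

lemma block (ini : List ℕ) (e : ℕ) (Q x : ℕ → ℕ)
    (h : (altLe (cat (ini ++ [e + 1]) Q) x ∧ altLe x (cat (ini ++ [e, 0]) Q)) ∨
      (altLe (cat (ini ++ [e, 0]) Q) x ∧ altLe x (cat (ini ++ [e + 1]) Q))) :
    (∃ y, x = cat (ini ++ [e + 1]) y) ∨ (∃ y, x = cat (ini ++ [e, 0]) y) := by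
  simp only [cat_append] at h ⊢
  obtain ⟨z, rfl⟩ : ∃ z, x = cat ini z := by
    rcases h with h | h
    · exact sandwich _ _ _ _ h.1 h.2
    · exact sandwich _ _ _ _ h.1 h.2
  have core : altLe (cons (e + 1) Q) z ∧ altLe z (cons e (cons 0 Q)) := by
    simp only [cat_cons, cat_nil] at h
    by_cases hev : Even ini.length
    · simp only [le_cat_even hev] at h
      rcases h with h | h
      · exact h
      · have h1 := le_head h.1
        have h2 := le_head h.2
        simp at h1 h2
        omega
    · simp only [le_cat_odd hev] at h
      rcases h with h | h
      · have h1 := le_head h.1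
        have h2 := le_head h.2
        simp at h1 h2
        omega
      · exact ⟨h.2, h.1⟩
  obtain ⟨c1, c2⟩ := core
  rw [← cons_eta z, le_cons] at c1 c2
  rcases Nat.lt_or_ge (z 0) (e + 1) with h1 | h1
  · right
    have hz : z 0 = e := by omega
    have h3 : altLe (cons 0 Q) (shiftSeq z 1) := by
      rcases c2 with c2 | c2
      · omega
      · exact c2.2
    have h4 := le_head h3
    simp at h4
    refine ⟨shiftSeq (shiftSeq z 1) 1, ?_⟩
    rw [← cons_eta z, hz, ← cons_eta (shiftSeq z 1), h4]
    simp
  · left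
    have hz : z 0 = e + 1 := by omega
    refine ⟨shiftSeq z 1, ?_⟩
    rw [← cons_eta z, hz]
    simp

lemma assemble {A C : List ℕ} {P Q a : ℕ → ℕ} {n : ℕ} {L : ℝ} (hn : 1 ≤ n)
    (hA : Even A.length) (hC : ¬ Even C.length) (hnA : n ≤ A.length) (hnC : n ≤ C.length)
    (hQA : Q = cat A Q) (hPC : P = cat C Q) (hQ : IsAltLyndon Q)
    (hblock : ∀ x, altLe P x → altLe x Q → (∃ y, x = cat A y) ∨ (∃ y, x = cat C y))
    (hE : EntropyIs Q L) (hL : Real.log 2 / n ≤ L) (h1 : altLe P a) (h2 : altLe a Q) :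
    EntropyIs a L := by
  refine entropy_final hn hL (Hword_pos hQ) (fun N => Hword_mono_seq h2 N) (fun N => ?_) hE
  refine (Hword_mono_seq h1 N).trans ((main_count hQ (le_trans' h1 h2) N).trans ?_)
  refine Finset.sum_le_sum fun t _ => Nat.mul_le_mul_left _ ?_
  refine block_count (d := P) (fun x hx => hx.1) A C n hn hnA hnC ?_ _
  rintro x ⟨hx1, hx2⟩
  have hPx := sys_le hx1
  rcases hblock x hPx hx2 with ⟨y, rfl⟩ | ⟨y, rfl⟩
  · refine ⟨y, ⟨sys_cat hx1, ?_⟩, Or.inl rfl⟩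
    rw [hQA, le_cat_even hA] at hx2
    exact hx2
  · refine ⟨y, ⟨sys_cat hx1, ?_⟩, Or.inr rfl⟩
    rw [hPC, le_cat_odd hC] at hPx
    exact hPx

def LtAt (D : ℕ) (x y : ℕ → ℕ) : Prop :=
  (∀ i < D, x i = y i) ∧ (if Even D then y D < x D else x D < y D)

lemma LtAt_cat {D : ℕ} {u : List ℕ} {x y : ℕ → ℕ} (hu : ¬ Even u.length)
    (h : LtAt D (cat u x) (cat u y)) : u.length ≤ D ∧ LtAt (D - u.length) y x := by
  have hle : u.length ≤ D := by
    by_contra hlt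
    have h2 := h.2
    have hlt' : D < u.length := by omega
    simp only [cat_apply, if_pos hlt'] at h2
    split_ifs at h2 <;> omega
  refine ⟨hle, ?_⟩
  obtain ⟨j, rfl⟩ := Nat.exists_eq_add_of_le hle
  have ha : ∀ (z : ℕ → ℕ) i, cat u z (u.length + i) = z i := by
    intro z i; rw [cat_apply, if_neg (by omega)]; simp
  rw [Nat.add_sub_cancel_left]
  refine ⟨fun i hi => ?_, ?_⟩
  · have := h.1 (u.length + i) (by omega)
    rw [ha, ha] at this
    exact this.symm
  · have h2 := h.2
    rw [ha, ha] at h2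
    by_cases hj : Even j <;> simp [hj, hu, Nat.even_add] at h2 ⊢ <;> exact h2

lemma Q_lyndon (ini : List ℕ) (e : ℕ) (p Q : ℕ → ℕ) (hp : p = cat (ini ++ [e + 1]) p)
    (hQ : Q = periodicSeq (ini ++ [e, 0])) (hlyn : IsAltLyndon p)
    (hmin : ∀ j, 1 ≤ j → j ≤ ini.length → shiftSeq p j ≠ p) : IsAltLyndon Q := by
  have hQc : Q = cat (ini ++ [e, 0]) Q := by
    rw [hQ]; exact periodic_cat _ (by simp)
  have hpq : ∀ i < ini.length, Q i = p i := by
    intro i hi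
    rw [hQc, hp, cat_append, cat_append]
    simp only [cat_apply, if_pos hi]
  have hpm : p ini.length = e + 1 := by
    rw [hp, cat_append, cat_apply]; simp
  have hQm : Q ini.length = e := by
    rw [hQc, cat_append, cat_apply]; simp
  suffices H : ∀ D k, ¬ LtAt D (shiftSeq Q k) Q by
    intro k
    by_contra hk
    obtain ⟨D, hD⟩ := not_le'.1 hk
    exact H D k hD
  intro D
  induction D using Nat.strong_induction_on with
  | _ D ih =>
    intro k hk
    have hk' : ¬ altLe Q (shiftSeq Q k) := not_le'.2 ⟨D, hk⟩
    obtain ⟨k, hkk, hkn⟩ : ∃ k', shiftSeq Q k = shiftSeq Q k' ∧ k' < ini.length + 2 := by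
      refine ⟨k % (ini ++ [e, 0]).length, ?_, ?_⟩
      · rw [hQ]; exact shift_periodic_mod _ _
      · exact (Nat.mod_lt _ (by simp)).trans_le (by simp)
    rw [hkk] at hk hk'
    clear hkk
    rcases Nat.eq_zero_or_pos k with rfl | hk0
    · exact hk' (by rw [shift_zero]; exact le_refl' _)
    rcases Nat.lt_or_ge ini.length k with hkm | hkm
    · have hke : k = ini.length + 1 := by omega
      have hs : shiftSeq Q k = cons 0 Q := by
        have h1 : Q = cat (ini ++ [e]) (cons 0 Q) := by
          conv_lhs => rw [hQc]
          simp [cat_append]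
        have h2 := shift_cat_len (ini ++ [e]) (cons 0 Q)
        rw [← h1] at h2
        rw [hke]; simpa using h2
      rw [hs] at hk'
      apply hk'
      rcases Nat.eq_zero_or_pos (Q 0) with h0 | h0
      · rcases List.eq_nil_or_concat' ini with rfl | ⟨_, _, hh⟩
        · have he : e = 0 := by simpa [h0] using hQm.symm
          have : ∀ i, Q i = 0 := by
            intro i
            rw [hQ, he]
            simp only [periodicSeq, List.nil_append, List.length_cons, List.length_nil]
            have h3 : i % (0 + 1 + 1) < 2 := Nat.mod_lt _ (by norm_num)
            generalize i % (0 + 1 + 1) = j at h3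
            interval_cases j <;> rfl
          left
          funext i
          rcases i with _ | i
          · simp [this]
          · simp [this]
        · have hpos : 0 < ini.length := by rw [hh]; simp
          have h1 := hpq 0 hpos
          have h2 := le_head (hlyn ini.length)
          simp only [shiftSeq, add_zero] at h2
          omega
      · rw [← cons_eta Q, le_cons]
        exact Or.inl h0
    · set v := ini.drop k with hv
      have hvl : v.length = ini.length - k := by simp [hv]
      have hsQ : shiftSeq Q k = cat v (cons e (cons 0 Q)) := by
        conv_lhs => rw [hQc]
        rw [cat_append, shift_cat _ _ _ hkm]; rfl
      have hsp : shiftSeq p k = cat v (cons (e + 1) p) := by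
        conv_lhs => rw [hp]
        rw [cat_append, shift_cat _ _ _ hkm]; rfl
      have hpre : pre Q v.length = pre p v.length := by
        unfold pre
        apply List.map_congr_left
        intro i hi
        simp at hi
        exact hpq i (by omega)
      have hl := hlyn k
      rw [hsp] at hl
      have hhead : Q v.length = p v.length := hpq _ (by omega)
      by_cases hne : pre p v.length = v
      · have hpd : p = cat v (shiftSeq p v.length) := by
          conv_lhs => rw [← cat_pre p v.length, hne]
        have hQd : Q = cat v (shiftSeq Q v.length) := by
          conv_lhs => rw [← cat_pre Q v.length, hpre, hne]
        by_cases hev : Even v.length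
        · apply hk'
          rw [hsQ]
          have hl2 : altLe (shiftSeq p v.length) (cons (e + 1) p) := by
            rw [← le_cat_even hev, ← hpd]; exact hl
          have hl3 := le_head hl2
          simp [shiftSeq] at hl3
          have : altLe (cat v (shiftSeq Q v.length)) (cat v (cons e (cons 0 Q))) := by
            rw [le_cat_even hev, ← cons_eta (shiftSeq Q v.length), le_cons]
            left
            simp [shiftSeq]
            omega
          rwa [← hQd] at this
        · have hl2 : altLe (cons (e + 1) p) (shiftSeq p v.length) := by
            rw [← le_cat_odd hev, ← hpd]; exact hl
          have red : ¬ altLe (cons e (cons 0 Q)) (shiftSeq Q v.length) := by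
            rw [← le_cat_odd hev, ← hQd, ← hsQ]; exact hk'
          rw [← cons_eta (shiftSeq p v.length), le_cons, shift_shift] at hl2
          rw [← cons_eta (shiftSeq Q v.length), le_cons, shift_shift] at red
          have e1 : shiftSeq p v.length 0 = p v.length := rfl
          have e2 : shiftSeq Q v.length 0 = Q v.length := rfl
          rw [e1] at hl2
          rw [e2] at red
          rcases hl2 with hl2 | ⟨hl2, hl3⟩
          · have hqe : Q v.length = e := by
              by_contra hc
              exact red (Or.inl (by omega))
            have red2 : ¬ altLe (shiftSeq Q (v.length + 1)) (cons 0 Q) :=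
              fun hh => red (Or.inr ⟨hqe.symm, hh⟩)
            rw [← cons_eta (shiftSeq Q (v.length + 1)), le_cons] at red2
            have hz : shiftSeq Q (v.length + 1) 0 = 0 := by
              by_contra hc
              exact red2 (Or.inl (by omega))
            have hQu : Q = cat (v ++ [e, 0]) (shiftSeq Q (v.length + 2)) := by
              conv_lhs => rw [hQd, ← cons_eta (shiftSeq Q v.length), shift_shift, e2, hqe,
                ← cons_eta (shiftSeq Q (v.length + 1)), hz, shift_shift]
              rw [cat_append]; rfl
            have hsu : shiftSeq Q k = cat (v ++ [e, 0]) Q := by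
              rw [hsQ, cat_append]; rfl
            rw [hsu] at hk
            have hk3 : LtAt D (cat (v ++ [e, 0]) Q)
                (cat (v ++ [e, 0]) (shiftSeq Q (v.length + 2))) := by
              rw [← hQu]; exact hk
            have hodd : ¬ Even (v ++ [e, 0]).length := by
              simp [Nat.even_add]; simpa using hev
            obtain ⟨hD1, hD2⟩ := LtAt_cat hodd hk3
            have hlen : 0 < (v ++ [e, 0]).length := by simp
            exact ih (D - (v ++ [e, 0]).length) (by omega) _ hD2
          · exact hmin (v.length + 1) (by omega) (by omega)
              (le_antisymm' hl3 (hlyn _))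
      · apply hk'
        rw [hsQ]
        rw [← cat_pre p v.length] at hl
        have := le_cat_ne _ _ (by simp) hne _ _ (shiftSeq Q v.length) (cons e (cons 0 Q)) hl
        rwa [← hpre, cat_pre] at this

lemma zero_contra {p : ℕ → ℕ} (hl : IsAltLyndon p) (h0 : p 0 = 0) {L : ℝ} (hL : 0 < L)
    (hE : EntropyIs p L) : False := by
  have h1 : ∀ N, Hword p N ≤ 1 := by
    intro N
    rw [Hword_eq]
    refine (Set.ncard_le_ncard (t := {pre (fun _ => 0) N}) ?_ (Set.finite_singleton _)).trans
      (by simp)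
    rintro _ ⟨x, hx, rfl⟩
    have : x = fun _ => 0 := by
      funext i
      have := hx.1 i
      omega
    rw [this]; rfl
  have h2 : Tendsto (fun N : ℕ => Real.log (Hword p N) / N) atTop (𝓝 0) := by
    refine entropy_poly (K := 1) (k := 0) one_pos (Hword_pos hl) (fun N => ?_)
    simpa using h1 N
  exact hL.ne (tendsto_nhds_unique h2 hE)

lemma odd_entropy (ini : List ℕ) (e : ℕ) (p Q : ℕ → ℕ) (hp : p = cat (ini ++ [e + 1]) p)
    (hQc : Q = cat (ini ++ [e, 0]) Q) (hQ : IsAltLyndon Q) (hev : Even ini.length)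
    {L : ℝ} (hE : EntropyIs p L) : EntropyIs Q L := by
  have hA : Even (ini ++ [e, 0]).length := by
    simp [Nat.even_add]; simpa using hev
  have hC : ¬ Even (ini ++ [e + 1]).length := by
    simp [Nat.even_add]; simpa using hev
  have hpQ : altLe p Q := by
    rw [hp, hQc, cat_append, cat_append, le_cat_even hev]
    simp only [cat_cons, cat_nil]
    rw [le_cons]
    left; omega
  have hwQ : altLe (cat (ini ++ [e + 1]) Q) p := by
    conv_rhs => rw [hp]
    rw [le_cat_odd hC]; exact hpQ
  have hcount : ∀ m, (Pfx {x | x ∈ LyndonSystem p ∧ altLe x Q} m).ncard ≤ m + 1 := by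
    intro m
    refine tail_count (d := p) (s := p) (fun x hx => hx.1) (ini ++ [e, 0]) (by simp) ?_ m
    rintro x ⟨hx1, hx2⟩
    have hpx := sys_le hx1
    have hxQ : altLe x (cat (ini ++ [e, 0]) Q) := by rw [← hQc]; exact hx2
    rcases block ini e Q x (Or.inl ⟨le_trans' hwQ hpx, hxQ⟩) with ⟨y, rfl⟩ | ⟨y, rfl⟩
    · left
      have hy : altLe (cat (ini ++ [e + 1]) p) (cat (ini ++ [e + 1]) y) := by
        rw [← hp]; exact hpx
      rw [le_cat_odd hC] at hy
      have := le_antisymm' hy (sys_le (sys_cat hx1))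
      rw [this, ← hp]
    · right
      refine ⟨y, ⟨sys_cat hx1, ?_⟩, rfl⟩
      rwa [le_cat_even hA] at hxQ
  refine squeeze_poly_rev (g := Hword p) (K := 1) (k := 2) one_pos (Hword_pos hQ)
    (fun N => Hword_mono_seq hpQ N) (fun N => ?_) hE
  have h1 : Hword p N ≤ (N + 1) ^ 2 * Hword Q N := by
    refine (main_count hQ hpQ N).trans ?_
    calc _ ≤ ∑ t ∈ Finset.range (N + 1), Hword Q N * (N + 1) := by
          refine Finset.sum_le_sum fun t ht => ?_
          have ht' : t ≤ N := by simp at ht; omega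
          exact Nat.mul_le_mul (Hword_mono Q ht') ((hcount _).trans (by omega))
      _ = _ := by rw [Finset.sum_const, Finset.card_range, smul_eq_mul]; ring
  rw [one_mul]
  exact_mod_cast h1

end AltL

/-- Proposition 10: if `\overline{d_1⋯d_n}` (with `n` minimal) is a weak alternate
Lyndon word associated to `β > 1`, then every alternate Lyndon word in the stated
interval (depending on the parity of `n`) is associated to `β`. -/
theorem stmt18 (w : List ℕ) (hw : 1 ≤ w.length)
    (hlyn : IsAltLyndon (periodicSeq w))
    (hmin : ∀ m : ℕ, 1 ≤ m → m < w.length →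
      ¬ ∀ i, periodicSeq w (i + m) = periodicSeq w i)
    (β : ℝ) (hβ : 1 < β) (hE : EntropyIs (periodicSeq w) (Real.log β))
    (a : ℕ → ℕ) (ha : IsAltLyndon a)
    (hrange : if Even w.length
      then altLe (prefixPeriodic (modList w) w) a ∧ altLe a (periodicSeq w)
      else altLe (prefixPeriodic w (modList w)) a ∧ altLe a (periodicSeq (modList w))) :
    EntropyIs a (Real.log β) := by
  have hL0 : 0 < Real.log β := Real.log_pos hβ
  have hLB := AltL.lower_bound w hw hlyn hL0 hE
  have hpc := AltL.periodic_cat w hw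
  obtain ⟨ini, l, rfl⟩ : ∃ ini l, w = ini ++ [l] := by
    rcases List.eq_nil_or_concat' w with rfl | h
    · simp at hw
    · exact h
  have hmod : modList (ini ++ [l]) = ini ++ [l - 1, 0] := by
    simp [modList]
  rw [hmod, AltL.prefixPeriodic_cat, AltL.prefixPeriodic_cat] at hrange
  set p := periodicSeq (ini ++ [l]) with hpdef
  set Q := periodicSeq (ini ++ [l - 1, 0]) with hQdef
  have hQc : Q = AltL.cat (ini ++ [l - 1, 0]) Q := AltL.periodic_cat _ (by simp)
  rcases Nat.eq_zero_or_pos l with hl0 | hl0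
  · exfalso
    refine AltL.zero_contra hlyn ?_ hL0 hE
    subst hl0
    by_cases hev : Even (ini ++ [0]).length
    · rw [if_pos hev] at hrange
      have h := AltL.le_trans' hrange.1 hrange.2
      rw [hpc] at h
      have h2 : AltL.cat (ini ++ [0 - 1, 0]) (AltL.cat (ini ++ [0]) p) =
          AltL.cat (ini ++ [0]) (AltL.cons 0 (AltL.cat (ini ++ [0]) p)) := by
        rw [AltL.cat_append, AltL.cat_append ini [0] (AltL.cons _ _)]; rfl
      rw [h2, AltL.le_cat_even hev, ← hpc] at h
      have := AltL.le_head h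
      simpa using this
    · rw [if_neg hev] at hrange
      have h := AltL.le_trans' hrange.1 hrange.2
      have h2 : Q = AltL.cat (ini ++ [0]) (AltL.cons 0 Q) := by
        conv_lhs => rw [hQc]
        rw [AltL.cat_append, AltL.cat_append]; rfl
      have h3 : altLe (AltL.cat (ini ++ [0]) Q) (AltL.cat (ini ++ [0]) (AltL.cons 0 Q)) := by
        rw [← h2]; exact h
      rw [AltL.le_cat_odd hev] at h3
      have h4 := AltL.le_head h3
      have h5 : Q 0 = p 0 := by
        rw [h2, hpc, AltL.cat_apply, AltL.cat_apply, if_pos (by simp), if_pos (by simp)]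
      simp at h4
      omega
  obtain ⟨e, rfl⟩ : ∃ e, l = e + 1 := ⟨l - 1, by omega⟩
  simp only [Nat.add_sub_cancel] at hrange hQc hQdef
  by_cases hev : Even (ini ++ [e + 1]).length
  · rw [if_pos hev] at hrange
    refine AltL.assemble (A := ini ++ [e + 1]) (C := ini ++ [e, 0]) hw hev ?_ le_rfl (by simp)
      hpc rfl hlyn ?_ hE hLB hrange.1 hrange.2
    · simp [Nat.even_add] at hev ⊢
      simpa using hev
    · intro x h1 h2
      rw [hpc] at h2
      exact AltL.block ini e p x (Or.inr ⟨h1, h2⟩)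
  · rw [if_neg hev] at hrange
    have hini : Even ini.length := by
      simp [Nat.even_add] at hev
      simpa using hev
    have hmin' : ∀ j, 1 ≤ j → j ≤ ini.length → shiftSeq p j ≠ p := by
      intro j hj1 hj2 he
      refine hmin j hj1 (by simp; omega) (fun i => ?_)
      have := congrFun he i
      rw [← this, shiftSeq, add_comm]
    have hQl : IsAltLyndon Q := AltL.Q_lyndon ini e p Q hpc hQdef hlyn hmin'
    have hQE := AltL.odd_entropy ini e p Q hpc hQc hQl hini hE
    refine AltL.assemble (A := ini ++ [e, 0]) (C := ini ++ [e + 1]) hw ?_ hev (by simp) le_rfl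
      hQc rfl hQl ?_ hQE hLB hrange.1 hrange.2
    · simp [Nat.even_add]
      simpa using hini
    · intro x h1 h2
      rw [hQc] at h2
      exact (AltL.block ini e Q x (Or.inl ⟨h1, h2⟩)).symm
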